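/- Assume CH. Let K be a nonempty countable set, let ⟨A_n : n ∈ ω⟩ be maximal antichains of Namba forcing, and let h_n : A_n → K for each n ∈ ω. Then the set of perfect trees Q for which there exists g : ω → K such that for every n ∈ ω every element a ∈ A_n compatible with Q satisfies h_n(a) = g(n), is dense in Namba forcing. (This is the order-theoretic form of the statement that, under CH, Namba forcing adds no new ω-sequences from a countable ground-model set.) -/

import Mathlib

namespace NambaTrees

noncomputable section

/-- The ordinal ω₂ (the second uncountable cardinal, as an ordinal). -/
def omega2 : Ordinal := (Cardinal.aleph 2).ord

/-- The set of extensions of `t` in `T`. -/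
def ext (T : Set (List Ordinal)) (t : List Ordinal) : Set (List Ordinal) :=
  {s | s ∈ T ∧ t <+: s}

/-- A tree: a set of finite sequences of ordinals below ω₂ closed under initial segments. -/
def IsTree (T : Set (List Ordinal)) : Prop :=
  (∀ t ∈ T, ∀ x ∈ t, x < omega2) ∧ ∀ s t : List Ordinal, s <+: t → t ∈ T → s ∈ T

/-- A perfect tree: a nonempty tree in which every element has ℵ₂-many extensions. -/
def IsPerfect (T : Set (List Ordinal)) : Prop :=
  IsTree T ∧ T.Nonempty ∧ ∀ t ∈ T, Cardinal.aleph 2 ≤ Cardinal.mk ↥(ext T t)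

/-- The derived trees `T^(α)`: `T^(0) = T`, `T^(α+1)` consists of the elements of `T^(α)`
with ℵ₂-many extensions in `T^(α)`, and intersections are taken at limits. -/
def derived (T : Set (List Ordinal)) (α : Ordinal) : Set (List Ordinal) :=
  Ordinal.limitRecOn α T
    (fun _ ih => {t | t ∈ ih ∧ Cardinal.aleph 2 ≤ Cardinal.mk ↥(ext ih t)})
    (fun o _ ih => {t | ∀ γ, ∀ h : γ < o, t ∈ ih γ h})

/-- The rank `h_T(t)`: the least `α` with `t ∉ T^(α)` (when it exists). -/
def rank (T : Set (List Ordinal)) (t : List Ordinal) : Ordinal :=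
  sInf {α | t ∉ derived T α}

end

end NambaTrees
namespace NambaTrees

/-- Two conditions of Namba forcing are compatible iff some perfect tree is contained in both. -/
def NambaCompatible (p q : Set (List Ordinal)) : Prop :=
  ∃ r : Set (List Ordinal), IsPerfect r ∧ r ⊆ p ∧ r ⊆ q

/-- A maximal antichain of Namba forcing: a set of pairwise incompatible perfect trees
such that every perfect tree is compatible with some member. -/
def NambaMaxAntichain (A : Set (Set (List Ordinal))) : Prop :=
  (∀ a ∈ A, IsPerfect a) ∧
  (A.Pairwise fun a b => ¬ NambaCompatible a b) ∧
  (∀ p : Set (List Ordinal), IsPerfect p → ∃ a ∈ A, NambaCompatible a p)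

end NambaTrees

namespace NambaTrees

open Cardinal

universe u v w

section Game

variable {σ : Type v} {I : Type u} {K : Type w}

/-- The position at stage `k` of the play `x` that starts from position `s` at stage `n`. -/
def run (next : ℕ → σ → I → σ) (n : ℕ) (s : σ) (x : ℕ → I) : ℕ → σ
  | 0 => s
  | k + 1 => next (n + k) (run next n s x k) (x k)

theorem run_tail (next : ℕ → σ → I → σ) (n : ℕ) (s : σ) (x : ℕ → I) (k : ℕ) :
    run next (n + 1) (next n s (x 0)) (fun j => x (j + 1)) k = run next n s x (k + 1) := by
  induction k with
  | zero => rfl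
  | succ k ih =>
    rw [run, ih, show n + 1 + k = n + (k + 1) by omega]
    rfl

/-- From position `s` at stage `n`, one can forbid fewer than `c` moves at each step so that every
play made of allowed moves has a label that differs from `g`. -/
def Avoidable (c : Cardinal.{u}) (next : ℕ → σ → I → σ) (val : ℕ → σ → I → K) (g : ℕ → K)
    (n : ℕ) (s : σ) : Prop :=
  ∃ E : List I → Set I, (∀ l, #(E l) < c) ∧
    ∀ x : ℕ → I, (∀ k, x k ∉ E (List.ofFn fun j : Fin k => x j)) →
      ∃ k, val (n + k) (run next n s x k) (x k) ≠ g (n + k)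

variable {c : Cardinal.{u}} {next : ℕ → σ → I → σ} {val : ℕ → σ → I → K} {g : ℕ → K}

theorem le_mk_of_not_avoidable (hc : c ≠ 0) {n : ℕ} {s : σ}
    (hs : ¬ Avoidable c next val g n s) :
    c ≤ #{i | val n s i = g n ∧ ¬ Avoidable c next val g (n + 1) (next n s i)} := by
  classical
  by_contra! hlt
  apply hs
  have hE : ∀ i, ∃ E : List I → Set I, (∀ l, #(E l) < c) ∧
      (Avoidable c next val g (n + 1) (next n s i) →
        ∀ x : ℕ → I, (∀ k, x k ∉ E (List.ofFn fun j : Fin k => x j)) →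
          ∃ k, val (n + 1 + k) (run next (n + 1) (next n s i) x k) (x k) ≠ g (n + 1 + k)) := by
    intro i
    by_cases h : Avoidable c next val g (n + 1) (next n s i)
    · obtain ⟨E, h1, h2⟩ := h
      exact ⟨E, h1, fun _ => h2⟩
    · exact ⟨fun _ => ∅, fun _ => by simpa using pos_iff_ne_zero.2 hc, fun h' => absurd h' h⟩
  choose E hsmall hplay using hE
  refine ⟨fun l => match l with
    | [] => {i | val n s i = g n ∧ ¬ Avoidable c next val g (n + 1) (next n s i)}
    | i :: l => E i l, ?_, ?_⟩
  · rintro (_ | ⟨i, l⟩)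
    · exact hlt
    · exact hsmall i l
  · intro x hx
    have h0 : ¬ (val n s (x 0) = g n ∧ ¬ Avoidable c next val g (n + 1) (next n s (x 0))) := by
      simpa using hx 0
    by_cases hv : val n s (x 0) = g n
    · have hav : Avoidable c next val g (n + 1) (next n s (x 0)) := by tauto
      obtain ⟨k, hk⟩ := hplay (x 0) hav (fun j => x (j + 1)) (fun k => by
        have := hx (k + 1)
        rw [List.ofFn_succ] at this
        exact this)
      refine ⟨k + 1, ?_⟩
      rw [run_tail, show n + 1 + k = n + (k + 1) by omega] at hk
      exact hk
    · exact ⟨0, hv⟩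

theorem exists_play (f : List I → I) : ∃ x : ℕ → I, ∀ k, x k = f (List.ofFn fun j : Fin k => x j) := by
  let L : ℕ → List I := fun k => Nat.rec [] (fun _ l => l ++ [f l]) k
  have hL : ∀ k, (List.ofFn fun j : Fin k => f (L j)) = L k := by
    intro k
    induction k with
    | zero => rfl
    | succ k ih =>
      rw [List.ofFn_succ_last]
      change (List.ofFn fun j : Fin k => f (L j)) ++ [f (L k)] = L k ++ [f (L k)]
      rw [ih]
  exact ⟨fun k => f (L k), fun k => by rw [hL]⟩

/-- If there are fewer than `c` sequences `ℕ → K`, with `c` regular, then not all of them are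
avoidable. -/
theorem exists_not_avoidable (hc : c.IsRegular) (hI : c ≤ #I)
    (hK : Cardinal.lift.{u} #(ℕ → K) < Cardinal.lift.{w} c) (s : σ) :
    ∃ g : ℕ → K, ¬ Avoidable c next val g 0 s := by
  by_contra! hall
  choose E hsmall hplay using hall
  have hf : ∀ l, ∃ i, ∀ g, i ∉ E g l := by
    intro l
    by_contra! hcov
    obtain ⟨κ, hκ⟩ : ∃ κ : Cardinal.{u}, Cardinal.lift.{w} κ = Cardinal.lift.{u} #(ℕ → K) :=
      Cardinal.mem_range_lift_of_le hK.le
    have hκc : #κ.out < c := by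
      rw [mk_out]
      rwa [← hκ, Cardinal.lift_lt] at hK
    obtain ⟨e⟩ : Nonempty (κ.out ≃ (ℕ → K)) := by
      rw [← Cardinal.lift_mk_eq', mk_out, hκ]
    have huniv : (⋃ j, E (e j) l) = Set.univ := by
      refine Set.eq_univ_of_forall fun i => ?_
      obtain ⟨g, hg⟩ := hcov i
      exact Set.mem_iUnion.2 ⟨e.symm g, by simpa using hg⟩
    have := (card_iUnion_lt_iff_forall_of_isRegular (t := fun j => E (e j) l) hc hκc).2
      fun j => hsmall _ _
    rw [huniv, mk_univ] at this
    exact this.not_ge hI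
  choose f hf using hf
  obtain ⟨x, hx⟩ := exists_play f
  obtain ⟨k, hk⟩ := hplay (fun k => val k (run next 0 s x k) (x k)) x fun k => by
    rw [hx k]
    exact hf _ _
  simp at hk

end Game

section Trees

variable {T r : Set (List Ordinal.{u})} {t : List Ordinal.{u}}

theorem isRegular_aleph_two : (aleph 2 : Cardinal.{u}).IsRegular := by
  have := isRegular_aleph_add_one (1 : Ordinal.{u})
  rwa [one_add_one_eq_two] at this

theorem IsPerfect.exists_level (hT : IsPerfect T) (ht : t ∈ T) :
    ∃ m, t.length < m ∧ aleph 2 ≤ #{s | s ∈ ext T t ∧ s.length = m} := by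
  have hbig := hT.2.2 t ht
  obtain ⟨m, hm⟩ : ∃ m : ULift.{u + 1} ℕ, ¬ #{s | s ∈ ext T t ∧ s.length = m.down} < aleph 2 := by
    by_contra! hsmall
    have h1 : #(ULift.{u + 1} ℕ) < aleph 2 := by
      rw [mk_eq_aleph0, ← aleph_zero]
      exact aleph_lt_aleph.2 two_pos
    have h2 := (card_iUnion_lt_iff_forall_of_isRegular isRegular_aleph_two h1).2 hsmall
    have h3 : ext T t ⊆ ⋃ m : ULift.{u + 1} ℕ, {s | s ∈ ext T t ∧ s.length = m.down} :=
      fun s hs => Set.mem_iUnion.2 ⟨⟨s.length⟩, hs, rfl⟩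
    exact ((mk_le_mk_of_subset h3).trans_lt h2).not_ge hbig
  rw [not_lt] at hm
  refine ⟨m.down, ?_, hm⟩
  by_contra! hle
  have hsub : {s | s ∈ ext T t ∧ s.length = m.down} ⊆ {t} := by
    rintro s ⟨⟨-, hs⟩, hlen⟩
    exact (hs.eq_of_length_le (by omega)).symm
  have h1 := hm.trans (mk_le_mk_of_subset hsub)
  rw [mk_singleton] at h1
  exact (one_lt_aleph0.trans_le isRegular_aleph_two.aleph0_le).not_ge h1

theorem IsPerfect.exists_length_ge (hT : IsPerfect T) (ht : t ∈ T) (m : ℕ) :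
    ∃ s ∈ T, t <+: s ∧ m ≤ s.length := by
  induction m with
  | zero => exact ⟨t, ht, List.prefix_rfl, Nat.zero_le _⟩
  | succ m ih =>
    obtain ⟨s, hs, hts, hm⟩ := ih
    obtain ⟨l, hl, hbig⟩ := hT.exists_level hs
    obtain ⟨⟨s', hs', hlen⟩⟩ := mk_ne_zero_iff.1
      ((aleph0_pos.trans_le isRegular_aleph_two.aleph0_le).trans_le hbig).ne'
    exact ⟨s', hs'.1, hts.trans hs'.2, by omega⟩

/-- The elements of `T` comparable with `t`. -/
def cone (T : Set (List Ordinal.{u})) (t : List Ordinal.{u}) : Set (List Ordinal.{u}) :=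
  {s | s ∈ T ∧ (s <+: t ∨ t <+: s)}

theorem cone_subset : cone T t ⊆ T := fun _ hs => hs.1

theorem IsPerfect.cone (hT : IsPerfect T) (ht : t ∈ T) : IsPerfect (cone T t) := by
  refine ⟨⟨fun s hs => hT.1.1 s hs.1, ?_⟩, ⟨t, ht, Or.inl List.prefix_rfl⟩, ?_⟩
  · rintro s s' hss ⟨hs', h | h⟩
    · exact ⟨hT.1.2 _ _ hss hs', Or.inl (hss.trans h)⟩
    · exact ⟨hT.1.2 _ _ hss hs', List.prefix_or_prefix_of_prefix hss h⟩
  · rintro s ⟨hs, h | h⟩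
    · exact (hT.2.2 t ht).trans (mk_le_mk_of_subset fun v hv => ⟨⟨hv.1, Or.inr hv.2⟩, h.trans hv.2⟩)
    · exact (hT.2.2 s hs).trans
        (mk_le_mk_of_subset fun v hv => ⟨⟨hv.1, Or.inr (h.trans hv.2)⟩, hv.2⟩)

theorem IsPerfect.mem_of_subset_cone (hr : IsPerfect r) (h : r ⊆ NambaTrees.cone T t) : t ∈ r := by
  obtain ⟨s, hs⟩ := hr.2.1
  obtain ⟨s', hs', -, hlen⟩ := hr.exists_length_ge hs t.length
  rcases (h hs').2 with h' | h'
  · rwa [← h'.eq_of_length_le hlen]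
  · exact hr.1.2 _ _ h' hs'

/-- `T` forces the value of the name given by `A` and `h` to be `k`. -/
def Decides {K : Type w} (A : Set (Set (List Ordinal.{u}))) (h : Set (List Ordinal.{u}) → K)
    (T : Set (List Ordinal.{u})) (k : K) : Prop :=
  ∀ a ∈ A, NambaCompatible a T → h a = k

theorem exists_decides {K : Type w} {A : Set (Set (List Ordinal.{u}))} (hA : NambaMaxAntichain A)
    (h : Set (List Ordinal.{u}) → K) (hT : IsPerfect T) :
    ∃ r, IsPerfect r ∧ r ⊆ T ∧ ∃ k, Decides A h r k := by
  obtain ⟨a, ha, r, hr, hra, hrT⟩ := hA.2.2 T hT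
  refine ⟨r, hr, hrT, h a, ?_⟩
  rintro b hb ⟨q, hq, hqb, hqr⟩
  by_contra hne
  exact hA.2.1 hb ha (fun hab => hne (by rw [hab])) ⟨q, hq, hqb, hqr.trans hra⟩

/-- A perfect tree with a distinguished node. -/
abbrev PointedTree : Type (u + 1) :=
  {p : Set (List Ordinal.{u}) × List Ordinal.{u} // IsPerfect p.1 ∧ p.2 ∈ p.1}

theorem exists_splitting {K : Type w} {A : Set (Set (List Ordinal.{u}))}
    (hA : NambaMaxAntichain A) (h : Set (List Ordinal.{u}) → K) (s : PointedTree.{u}) :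
    ∃ (m : ℕ) (next : (aleph.{u + 1} 2).out → PointedTree.{u}) (val : (aleph.{u + 1} 2).out → K),
      s.1.2.length < m ∧ (Function.Injective fun i => (next i).1.2) ∧
      ∀ i, (next i).1.2.length = m ∧ s.1.2 <+: (next i).1.2 ∧
        (next i).1.1 ⊆ cone s.1.1 (next i).1.2 ∧ Decides A h (next i).1.1 (val i) := by
  obtain ⟨⟨T, t⟩, hT, ht⟩ := s
  obtain ⟨m, hm, hbig⟩ := hT.exists_level ht
  rw [← mk_out (aleph.{u + 1} 2)] at hbig
  obtain ⟨e⟩ := Cardinal.le_def _ _ |>.1 hbig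
  have hdec := fun i => exists_decides hA h (hT.cone (e i).2.1.1)
  choose r hr hsub k hk using hdec
  exact ⟨m, fun i => ⟨(r i, e i), hr i, (hr i).mem_of_subset_cone (hsub i)⟩, k, hm,
    fun i j hij => e.injective (Subtype.ext hij),
    fun i => ⟨(e i).2.2, (e i).2.1.2, hsub i, hk i⟩⟩

/-- The tree spanned by the nodes reached from `s` along moves `i` with `i ∈ M n s`. -/
inductive Span {I : Type v} (next : ℕ → PointedTree.{u} → I → PointedTree.{u})
    (M : ℕ → PointedTree.{u} → Set I) : ℕ → PointedTree.{u} → List Ordinal.{u} → Prop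
  | base {n s t} : t <+: s.1.2 → Span next M n s t
  | step {n s i t} : i ∈ M n s → Span next M (n + 1) (next n s i) t → Span next M n s t

section Span

variable {I : Type (u + 1)} {next : ℕ → PointedTree.{u} → I → PointedTree.{u}}
  {M : ℕ → PointedTree.{u} → Set I} {m : ℕ → PointedTree.{u} → ℕ}

theorem Span.mem (hnext : ∀ n s i, (next n s i).1.1 ⊆ cone s.1.1 (next n s i).1.2)
    {n s} (ht : Span next M n s t) : t ∈ s.1.1 := by
  induction ht with
  | @base _ s _ h => exact s.2.1.1.2 _ _ h s.2.2
  | step _ _ ih => exact (hnext _ _ _ ih).1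

theorem Span.of_prefix {n s t'} (ht : Span next M n s t) (h : t' <+: t) : Span next M n s t' := by
  induction ht with
  | base h' => exact .base (h.trans h')
  | step hi _ ih => exact .step hi (ih h)

/-- The spanned tree is perfect if each position in `G n` has `ℵ₂` many moves, all into `G (n + 1)`. -/
theorem isPerfect_span {G : ℕ → Set PointedTree.{u}}
    (hnext : ∀ n s i, (next n s i).1.1 ⊆ cone s.1.1 (next n s i).1.2)
    (hext : ∀ n s i, s.1.2 <+: (next n s i).1.2)
    (hinj : ∀ n s, Function.Injective fun i => (next n s i).1.2)
    (hG : ∀ n, ∀ s ∈ G n, aleph 2 ≤ #(M n s))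
    (hMG : ∀ n s, ∀ i ∈ M n s, next n s i ∈ G (n + 1)) {n s} (hs : s ∈ G n) :
    IsPerfect {t | Span next M n s t} := by
  refine ⟨⟨fun t ht => s.2.1.1.1 t (Span.mem hnext ht), fun t t' h ht => Span.of_prefix ht h⟩,
    ⟨s.1.2, .base List.prefix_rfl⟩, ?_⟩
  intro t ht
  induction ht with
  | @base n s t h =>
    refine (hG n s hs).trans ?_
    refine mk_le_of_injective (f := fun i => ⟨(next n s i.1).1.2,
      Span.step i.2 (Span.base List.prefix_rfl), h.trans (hext _ _ _)⟩) ?_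
    intro i j hij
    exact Subtype.ext (hinj n s (congrArg Subtype.val hij))
  | step hi _ ih =>
    exact (ih (hMG _ _ _ hi)).trans (mk_le_mk_of_subset fun v hv => ⟨Span.step hi hv.1, hv.2⟩)

theorem exists_subset_span_next
    (hnext : ∀ n s i, (next n s i).1.1 ⊆ cone s.1.1 (next n s i).1.2)
    (hinj : ∀ n s, Function.Injective fun i => (next n s i).1.2)
    (hm : ∀ n s, s.1.2.length < m n s) (hlen : ∀ n s i, (next n s i).1.2.length = m n s)
    {n s} (hr : IsPerfect r) (hrs : r ⊆ {t | Span next M n s t}) :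
    ∃ q, IsPerfect q ∧ q ⊆ r ∧ ∃ i ∈ M n s, q ⊆ {t | Span next M (n + 1) (next n s i) t} := by
  have key : ∀ v ∈ r, m n s ≤ v.length → ∃ i ∈ M n s,
      Span next M (n + 1) (next n s i) v ∧ (next n s i).1.2 <+: v := by
    intro v hv hlv
    cases hrs hv with
    | base h => exact absurd h.length_le (by have := hm n s; omega)
    | @step _ _ i _ hi h =>
      refine ⟨i, hi, h, ?_⟩
      rcases (hnext _ _ _ (h.mem hnext)).2 with h' | h'
      · rw [h'.eq_of_length_le (by rw [hlen]; exact hlv)]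
      · exact h'
  obtain ⟨t, ht⟩ := hr.2.1
  obtain ⟨v, hv, -, hlv⟩ := hr.exists_length_ge ht (m n s)
  obtain ⟨i, hi, hiv, hpre⟩ := key v hv hlv
  refine ⟨cone r v, hr.cone hv, cone_subset, i, hi, ?_⟩
  rintro w ⟨hw, h | h⟩
  · exact hiv.of_prefix h
  · obtain ⟨j, hj, hjw, hpre'⟩ := key w hw (hlv.trans h.length_le)
    have hij : i = j := hinj n s ((List.prefix_of_prefix_length_le (hpre.trans h) hpre'
      (by simp [hlen])).eq_of_length (by simp [hlen]))
    rwa [hij]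

theorem exists_subset_span
    (hnext : ∀ n s i, (next n s i).1.1 ⊆ cone s.1.1 (next n s i).1.2)
    (hinj : ∀ n s, Function.Injective fun i => (next n s i).1.2)
    (hm : ∀ n s, s.1.2.length < m n s) (hlen : ∀ n s i, (next n s i).1.2.length = m n s)
    {s} (hr : IsPerfect r) (hrs : r ⊆ {t | Span next M 0 s t}) (n : ℕ) :
    ∃ q, IsPerfect q ∧ q ⊆ r ∧ ∃ s', q ⊆ {t | Span next M n s' t} := by
  induction n with
  | zero => exact ⟨r, hr, subset_rfl, s, hrs⟩
  | succ n ih =>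
    obtain ⟨q, hq, hqr, s', hqs⟩ := ih
    obtain ⟨q', hq', hqq, i, -, hi⟩ := exists_subset_span_next hnext hinj hm hlen hq hqs
    exact ⟨q', hq', hqq.trans hqr, _, hi⟩

end Span

theorem mk_nat_fun_lt_aleph_two (ch : (2 : Cardinal.{v}) ^ aleph.{v} 0 = aleph.{v} 1)
    (K : Type) [Countable K] :
    Cardinal.lift.{u} #(ℕ → K) < Cardinal.lift.{0} (aleph.{u} 2) := by
  have hcont : continuum.{0} = aleph 1 := by
    apply Cardinal.lift_injective.{v}
    rw [lift_continuum, ← two_power_aleph0, ← aleph_zero, ch]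
    simp
  have hle : #(ℕ → K) ≤ continuum := by
    rw [← power_def, mk_nat, ← aleph0_power_aleph0]
    exact power_le_power_right (mk_le_aleph0 (α := K))
  have : #(ℕ → K) < aleph 2 := (hle.trans hcont.le).trans_lt (aleph_lt_aleph.2 one_lt_two)
  simpa using Cardinal.lift_lt.{0, u}.2 this

end Trees

end NambaTrees

open NambaTrees in
/-- Assume CH. Given maximal antichains `⟨A_n : n ∈ ω⟩` of Namba forcing and colorings
`h_n : A_n → K` into a countable nonempty set `K`, the set of conditions `Q` for which
there is `g : ω → K` with `h_n(a) = g(n)` for every `n` and every `a ∈ A_n` compatible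
with `Q`, is dense in Namba forcing. -/
theorem namba_reads_function_of_CH (ch : (2 : Cardinal) ^ Cardinal.aleph 0 = Cardinal.aleph 1)
    {K : Type} [Countable K] [Nonempty K]
    (A : ℕ → Set (Set (List Ordinal))) (hA : ∀ n : ℕ, NambaMaxAntichain (A n))
    (h : ℕ → Set (List Ordinal) → K) :
    ∀ p : Set (List Ordinal), IsPerfect p →
      ∃ Q : Set (List Ordinal), IsPerfect Q ∧ Q ⊆ p ∧
        ∃ g : ℕ → K, ∀ n : ℕ, ∀ a ∈ A n, NambaCompatible a Q → h n a = g n := by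
  intro p hp
  obtain ⟨t, ht⟩ := hp.2.1
  choose m next val hm hinj hspec using fun n s => exists_splitting (hA n) (h n) s
  have hlen := fun n s i => (hspec n s i).1
  have hext := fun n s i => (hspec n s i).2.1
  have hnext := fun n s i => (hspec n s i).2.2.1
  have hdec := fun n s i => (hspec n s i).2.2.2
  let s₀ : PointedTree := ⟨(p, t), hp, ht⟩
  obtain ⟨g, hg⟩ := exists_not_avoidable (next := next) (val := val) isRegular_aleph_two
    (Cardinal.mk_out _).ge (mk_nat_fun_lt_aleph_two ch K) s₀
  let G : ℕ → Set PointedTree := fun n => {s | ¬ Avoidable (Cardinal.aleph 2) next val g n s}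
  let M := fun n s => {i | val n s i = g n ∧ next n s i ∈ G (n + 1)}
  refine ⟨{t | Span next M 0 s₀ t}, ?_, fun t ht => Span.mem hnext ht, g, ?_⟩
  · exact isPerfect_span (G := G) hnext hext hinj
      (fun n s hs => le_mk_of_not_avoidable isRegular_aleph_two.pos.ne' hs)
      (fun n s i hi => hi.2) hg
  · rintro n a ha ⟨r, hr, hra, hrQ⟩
    obtain ⟨q, hq, hqr, s, hqs⟩ := exists_subset_span hnext hinj hm hlen hr hrQ n
    obtain ⟨q', hq', hqq, i, hi, hqi⟩ := exists_subset_span_next hnext hinj hm hlen hq hqs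
    rw [← hi.1]
    exact hdec n s i a ha ⟨q', hq', (hqq.trans hqr).trans hra, fun t ht => (hqi ht).mem hnext⟩
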